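/- For every integer k ≥ 0, the number of maximal cliques C of routes of G(H) (with respect to the canonical bipartite framing) such that exactly k maximal cliques are obtained from C by a single counterclockwise rotation equals m_k, the number of k-matchings of W(H). -/

import Mathlib

open Finset Filter Pointwise

/-- Neighbors in the right shore `T` of a left vertex `i`. -/
def Nbr (E : Finset (ℕ × ℕ)) (i : ℕ) : Finset ℕ :=
  (E.filter (fun p => p.1 = i)).image Prod.snd

/-- Neighbors in the left shore `S` of a right vertex `j`. -/
def Nbr' (E : Finset (ℕ × ℕ)) (j : ℕ) : Finset ℕ :=
  (E.filter (fun p => p.2 = j)).image Prod.fst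

/-- A route of `G(H)`: a triple `(a, (i,j), c)` with `a, c ∈ {1,2}`, `(i,j) ∈ E`,
representing the path `α_{a,i} β_{i,j} γ_{j,c}`. -/
abbrev Route : Type := ℕ × (ℕ × ℕ) × ℕ

def IsRoute (E : Finset (ℕ × ℕ)) (r : Route) : Prop :=
  (r.1 = 1 ∨ r.1 = 2) ∧ r.2.1 ∈ E ∧ (r.2.2 = 1 ∨ r.2.2 = 2)

/-- Two routes are in conflict with respect to the canonical bipartite framing. -/
def Conflict (r r' : Route) : Prop :=
  (r.2.1 = r'.2.1 ∧
    ((r.1 = 1 ∧ r.2.2 = 2 ∧ r'.1 = 2 ∧ r'.2.2 = 1) ∨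
     (r.1 = 2 ∧ r.2.2 = 1 ∧ r'.1 = 1 ∧ r'.2.2 = 2))) ∨
  (r.2.1.1 = r'.2.1.1 ∧ r.2.1.2 ≠ r'.2.1.2 ∧
    ((r.2.1.2 < r'.2.1.2 ∧ r'.1 = 1 ∧ r.1 = 2) ∨
     (r'.2.1.2 < r.2.1.2 ∧ r.1 = 1 ∧ r'.1 = 2))) ∨
  (r.2.1.2 = r'.2.1.2 ∧ r.2.1.1 ≠ r'.2.1.1 ∧
    ((r.2.1.1 < r'.2.1.1 ∧ r.2.2 = 2 ∧ r'.2.2 = 1) ∨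
     (r'.2.1.1 < r.2.1.1 ∧ r'.2.2 = 2 ∧ r.2.2 = 1)))

/-- A clique: a set of pairwise coherent routes. -/
def IsClique (E : Finset (ℕ × ℕ)) (C : Set Route) : Prop :=
  (∀ r ∈ C, IsRoute E r) ∧ ∀ r ∈ C, ∀ r' ∈ C, r ≠ r' → ¬ Conflict r r'

/-- A maximal clique of routes. -/
def IsMaxClique (E : Finset (ℕ × ℕ)) (C : Set Route) : Prop :=
  IsClique E C ∧ ∀ C' : Set Route, IsClique E C' → C ⊆ C' → C' = C

/-- Edges of the almost-degree-whiskered graph `W(H)`: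
`Sum.inl (i,j)` is the edge `{i,j}` of `H`;
`Sum.inr (Sum.inl (i,j))` is the pendant edge `{i, w_{i,j}}`;
`Sum.inr (Sum.inr (j,i))` is the pendant edge `{j, w'_{j,i}}`. -/
abbrev WEdge : Type := (ℕ × ℕ) ⊕ ((ℕ × ℕ) ⊕ (ℕ × ℕ))

def IsWEdge (E : Finset (ℕ × ℕ)) : WEdge → Prop
  | Sum.inl p => p ∈ E
  | Sum.inr (Sum.inl p) => p ∈ E ∧ ∃ j' ∈ Nbr E p.1, j' < p.2
  | Sum.inr (Sum.inr q) => (q.2, q.1) ∈ E ∧ ∃ i' ∈ Nbr' E q.1, q.2 < i'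

/-- The `H`-vertex of the left shore covered by an edge of `W(H)`, if any. -/
def leftV : WEdge → Option ℕ
  | Sum.inl p => some p.1
  | Sum.inr (Sum.inl p) => some p.1
  | Sum.inr (Sum.inr _) => none

/-- The `H`-vertex of the right shore covered by an edge of `W(H)`, if any. -/
def rightV : WEdge → Option ℕ
  | Sum.inl p => some p.2
  | Sum.inr (Sum.inl _) => none
  | Sum.inr (Sum.inr q) => some q.1

/-- A matching of `W(H)`: a set of pairwise disjoint edges of `W(H)`.
(Leaf vertices are covered by at most one edge label automatically.) -/
def IsMatching (E : Finset (ℕ × ℕ)) (M : Set WEdge) : Prop :=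
  (∀ e ∈ M, IsWEdge E e) ∧
  ∀ e ∈ M, ∀ e' ∈ M, e ≠ e' →
    (leftV e = none ∨ leftV e ≠ leftV e') ∧
    (rightV e = none ∨ rightV e ≠ rightV e')

/-- `mCount E k` is `m_k`, the number of `k`-matchings of `W(H)`. -/
noncomputable def mCount (E : Finset (ℕ × ℕ)) (k : ℕ) : ℕ :=
  {M : Set WEdge | IsMatching E M ∧ M.ncard = k}.ncard

/-- `r` is clockwise from `r'` with respect to the canonical bipartite framing. -/
def Clockwise (r r' : Route) : Prop :=
  (r.2.1 = r'.2.1 ∧ r.1 = 1 ∧ r.2.2 = 2 ∧ r'.1 = 2 ∧ r'.2.2 = 1) ∨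
  (r.2.1.1 = r'.2.1.1 ∧ r'.2.1.2 < r.2.1.2 ∧ r.1 = 1 ∧ r'.1 = 2) ∨
  (r.2.1.2 = r'.2.1.2 ∧ r.2.1.1 < r'.2.1.1 ∧ r.2.2 = 2 ∧ r'.2.2 = 1)

/-- `C'` is obtained from `C` by a single counterclockwise rotation. -/
def CCWStep (C C' : Set Route) : Prop :=
  ∃ r ∈ C, ∃ r' ∈ C', Clockwise r r' ∧ C \ {r} = C' \ {r'}

/-- A threshold for every vertex of `H`, together with a set of edges of `H`, intended to be tight
for both of their ends. -/
structure ThresholdData where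
  left : ℕ → ℕ
  right : ℕ → ℕ
  diag : ℕ → ℕ → Prop

namespace ThresholdData

/-- Thresholds are neighbors, and the distinguished edges are tight at both ends. -/
structure Good (E : Finset (ℕ × ℕ)) (D : ThresholdData) : Prop where
  left_mem : ∀ i j, (i, j) ∈ E → (i, D.left i) ∈ E
  right_mem : ∀ i j, (i, j) ∈ E → (D.right j, j) ∈ E
  diag_tight : ∀ i j, D.diag i j → (i, j) ∈ E ∧ D.left i = j ∧ D.right j = i

/-- Equality of threshold data, up to junk values at isolated vertices. -/
structure Agree (E : Finset (ℕ × ℕ)) (D D' : ThresholdData) : Prop where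
  left_eq : ∀ i j, (i, j) ∈ E → D.left i = D'.left i
  right_eq : ∀ i j, (i, j) ∈ E → D.right j = D'.right j
  diag_iff : ∀ i j, D.diag i j ↔ D'.diag i j

/-- The clique of routes determined by threshold data. -/
def clique (E : Finset (ℕ × ℕ)) (D : ThresholdData) : Set Route :=
  {r | r.2.1 ∈ E ∧
    ((r.1 = 1 ∧ r.2.2 = 1 ∧ r.2.1.2 ≤ D.left r.2.1.1 ∧ r.2.1.1 ≤ D.right r.2.1.2) ∨
     (r.1 = 2 ∧ r.2.2 = 2 ∧ D.left r.2.1.1 ≤ r.2.1.2 ∧ D.right r.2.1.2 ≤ r.2.1.1) ∨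
     (r.1 = 1 ∧ r.2.2 = 2 ∧ r.2.1.2 ≤ D.left r.2.1.1 ∧ D.right r.2.1.2 ≤ r.2.1.1 ∧
      (D.left r.2.1.1 = r.2.1.2 → D.right r.2.1.2 = r.2.1.1 → D.diag r.2.1.1 r.2.1.2)) ∨
     (r.1 = 2 ∧ r.2.2 = 1 ∧ D.left r.2.1.1 ≤ r.2.1.2 ∧ r.2.1.1 ≤ D.right r.2.1.2 ∧
      ¬ D.diag r.2.1.1 r.2.1.2))}

/-- The matching of `W(H)` determined by threshold data. -/
def matching (E : Finset (ℕ × ℕ)) (D : ThresholdData) : Set WEdge :=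
  {e | match e with
    | Sum.inl p => D.diag p.1 p.2
    | Sum.inr (Sum.inl p) =>
        p ∈ E ∧ D.left p.1 = p.2 ∧ ¬ D.diag p.1 p.2 ∧ ∃ j, (p.1, j) ∈ E ∧ j < p.2
    | Sum.inr (Sum.inr q) =>
        (q.2, q.1) ∈ E ∧ D.right q.1 = q.2 ∧ ¬ D.diag q.2 q.1 ∧ ∃ i, (i, q.1) ∈ E ∧ q.2 < i}

variable {E : Finset (ℕ × ℕ)} {D D' D'' : ThresholdData}

theorem mem_clique {a i j c : ℕ} : (a, (i, j), c) ∈ D.clique E ↔ (i, j) ∈ E ∧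
    ((a = 1 ∧ c = 1 ∧ j ≤ D.left i ∧ i ≤ D.right j) ∨
     (a = 2 ∧ c = 2 ∧ D.left i ≤ j ∧ D.right j ≤ i) ∨
     (a = 1 ∧ c = 2 ∧ j ≤ D.left i ∧ D.right j ≤ i ∧
      (D.left i = j → D.right j = i → D.diag i j)) ∨
     (a = 2 ∧ c = 1 ∧ D.left i ≤ j ∧ i ≤ D.right j ∧ ¬ D.diag i j)) :=
  Iff.rfl

theorem inl_mem_matching {i j : ℕ} : Sum.inl (i, j) ∈ D.matching E ↔ D.diag i j := Iff.rfl

theorem inr_inl_mem_matching {i j : ℕ} : Sum.inr (Sum.inl (i, j)) ∈ D.matching E ↔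
    (i, j) ∈ E ∧ D.left i = j ∧ ¬ D.diag i j ∧ ∃ j', (i, j') ∈ E ∧ j' < j := Iff.rfl

theorem inr_inr_mem_matching {i j : ℕ} : Sum.inr (Sum.inr (j, i)) ∈ D.matching E ↔
    (i, j) ∈ E ∧ D.right j = i ∧ ¬ D.diag i j ∧ ∃ i', (i', j) ∈ E ∧ i < i' := Iff.rfl

theorem Agree.symm (h : Agree E D D') : Agree E D' D :=
  ⟨fun i j hij => (h.left_eq i j hij).symm, fun i j hij => (h.right_eq i j hij).symm,
    fun i j => (h.diag_iff i j).symm⟩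

theorem Agree.clique_eq (h : Agree E D D') : D.clique E = D'.clique E := by
  obtain ⟨hl, hr, hd⟩ := h
  ext ⟨a, ⟨i, j⟩, c⟩
  simp only [mem_clique]
  refine and_congr_right fun hij => ?_
  rw [hl i j hij, hr i j hij, hd i j]

theorem Agree.matching_eq (h : Agree E D D') : D.matching E = D'.matching E := by
  obtain ⟨hl, hr, hd⟩ := h
  ext (⟨i, j⟩ | ⟨i, j⟩ | ⟨j, i⟩)
  · simp only [inl_mem_matching, hd]
  · simp only [inr_inl_mem_matching]
    refine and_congr_right fun hij => ?_
    rw [hl i j hij, hd i j]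
  · simp only [inr_inr_mem_matching]
    refine and_congr_right fun hij => ?_
    rw [hr i j hij, hd i j]

theorem isClique_clique : IsClique E (D.clique E) := by
  constructor
  · rintro ⟨a, ⟨i, j⟩, c⟩ h
    rw [mem_clique] at h
    simp only [IsRoute]
    grind
  · rintro ⟨a, ⟨i, j⟩, c⟩ h ⟨a', ⟨i', j'⟩, c'⟩ h' - hc
    rw [mem_clique] at h h'
    simp only [Conflict, Prod.mk.injEq] at hc
    rcases hc with ⟨⟨rfl, rfl⟩, hc⟩ | ⟨rfl, hne, hc⟩ | ⟨rfl, hne, hc⟩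
    · grind
    · omega
    · omega

theorem Good.exists_one_left_mem (h : D.Good E) {i j : ℕ} (hij : (i, j) ∈ E) :
    ∃ c, (1, (i, D.left i), c) ∈ D.clique E := by
  have := h.left_mem i j hij
  simp only [mem_clique]
  rcases le_total i (D.right (D.left i)) with h' | h'
  · exact ⟨1, by grind⟩
  · by_cases h2 : D.right (D.left i) = i
    · exact ⟨1, by grind⟩
    · exact ⟨2, by grind⟩

theorem Good.exists_two_left_mem (h : D.Good E) {i j : ℕ} (hij : (i, j) ∈ E) :
    ∃ c, (2, (i, D.left i), c) ∈ D.clique E := by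
  have := h.left_mem i j hij
  have := h.diag_tight i (D.left i)
  simp only [mem_clique]
  rcases le_or_gt (D.right (D.left i)) i with h' | h'
  · exact ⟨2, by grind⟩
  · exact ⟨1, by grind⟩

theorem Good.exists_one_right_mem (h : D.Good E) {i j : ℕ} (hij : (i, j) ∈ E) :
    ∃ a, (a, (D.right j, j), 1) ∈ D.clique E := by
  have := h.right_mem i j hij
  have := h.diag_tight (D.right j) j
  simp only [mem_clique]
  rcases le_or_gt j (D.left (D.right j)) with h' | h'
  · exact ⟨1, by grind⟩
  · exact ⟨2, by grind⟩

theorem Good.exists_two_right_mem (h : D.Good E) {i j : ℕ} (hij : (i, j) ∈ E) :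
    ∃ a, (a, (D.right j, j), 2) ∈ D.clique E := by
  have := h.right_mem i j hij
  have := h.diag_tight (D.right j) j
  simp only [mem_clique]
  rcases le_or_gt (D.left (D.right j)) j with h' | h'
  · exact ⟨2, by grind⟩
  · exact ⟨1, by grind⟩

theorem Good.agree_of_clique_subset (h : D.Good E) (h' : D'.Good E)
    (hs : D.clique E ⊆ D'.clique E) : Agree E D D' := by
  have hl : ∀ i j, (i, j) ∈ E → D.left i = D'.left i := by
    intro i j hij
    obtain ⟨c, hc⟩ := h.exists_one_left_mem hij
    obtain ⟨c', hc'⟩ := h.exists_two_left_mem hij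
    have h1 := mem_clique.1 (hs hc)
    have h2 := mem_clique.1 (hs hc')
    omega
  have hr : ∀ i j, (i, j) ∈ E → D.right j = D'.right j := by
    intro i j hij
    obtain ⟨c, hc⟩ := h.exists_one_right_mem hij
    obtain ⟨c', hc'⟩ := h.exists_two_right_mem hij
    have h1 := mem_clique.1 (hs hc)
    have h2 := mem_clique.1 (hs hc')
    omega
  refine ⟨hl, hr, fun i j => ⟨fun hd => ?_, fun hd => ?_⟩⟩
  · obtain ⟨hij, h1, h2⟩ := h.diag_tight i j hd
    have h3 : (1, (i, j), 2) ∈ D.clique E := mem_clique.2 (by grind)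
    have h4 := mem_clique.1 (hs h3)
    have := hl i j hij
    have := hr i j hij
    grind
  · obtain ⟨hij, h1, h2⟩ := h'.diag_tight i j hd
    by_contra hn
    have := hl i j hij
    have := hr i j hij
    have h3 : (2, (i, j), 1) ∈ D.clique E := mem_clique.2 (by grind)
    have h4 := mem_clique.1 (hs h3)
    grind

theorem exists_mem_between {N A B : Set ℕ} (hN : N.Nonempty) (hf : N.Finite) (hA : A ⊆ N)
    (hB : B ⊆ N) (hAB : ∀ a ∈ A, ∀ b ∈ B, a ≤ b) :
    ∃ x ∈ N, (∀ a ∈ A, a ≤ x) ∧ ∀ b ∈ B, x ≤ b := by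
  rcases A.eq_empty_or_nonempty with rfl | hne
  · obtain ⟨x, hx, hmin⟩ := Set.exists_min_image N id hf hN
    exact ⟨x, hx, by simp, fun b hb => hmin b (hB hb)⟩
  · obtain ⟨x, hx, hmax⟩ := Set.exists_max_image A id (hf.subset hA) hne
    exact ⟨x, hA hx, hmax, hAB x hx⟩

theorem finite_left_nbrs (E : Finset (ℕ × ℕ)) (i : ℕ) : {j | (i, j) ∈ E}.Finite :=
  (E.finite_toSet.image Prod.snd).subset fun j hj => ⟨(i, j), hj, rfl⟩

theorem finite_right_nbrs (E : Finset (ℕ × ℕ)) (j : ℕ) : {i | (i, j) ∈ E}.Finite :=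
  (E.finite_toSet.image Prod.fst).subset fun i hi => ⟨(i, j), hi, rfl⟩

theorem exists_good_clique_superset {C : Set Route} (hC : IsClique E C) :
    ∃ D : ThresholdData, D.Good E ∧ C ⊆ D.clique E := by
  obtain ⟨hR, hC⟩ := hC
  have hE : ∀ a i j c, (a, (i, j), c) ∈ C → (i, j) ∈ E := fun a i j c h => (hR _ h).2.1
  have hleft : ∀ i, ∃ x, ∀ j, (i, j) ∈ E → (i, x) ∈ E ∧
      (∀ y c, (1, (i, y), c) ∈ C → y ≤ x) ∧ ∀ y c, (2, (i, y), c) ∈ C → x ≤ y := by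
    intro i
    by_cases hN : ∃ j, (i, j) ∈ E
    · obtain ⟨x, hx, h1, h2⟩ := exists_mem_between (N := {j | (i, j) ∈ E})
        (A := {j | ∃ c, (1, (i, j), c) ∈ C}) (B := {j | ∃ c, (2, (i, j), c) ∈ C}) hN
        (finite_left_nbrs E i) (fun j ⟨c, hc⟩ => hE _ _ _ _ hc) (fun j ⟨c, hc⟩ => hE _ _ _ _ hc) (by
          rintro y ⟨c, hc⟩ z ⟨d, hd⟩
          by_contra hlt
          exact hC _ hc _ hd (by simp) (Or.inr (Or.inl
            ⟨rfl, (not_le.1 hlt).ne', Or.inr ⟨not_le.1 hlt, rfl, rfl⟩⟩)))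
      exact ⟨x, fun j _ => ⟨hx, fun y c h => h1 y ⟨c, h⟩, fun y c h => h2 y ⟨c, h⟩⟩⟩
    · exact ⟨0, fun j hj => (hN ⟨j, hj⟩).elim⟩
  have hright : ∀ j, ∃ x, ∀ i, (i, j) ∈ E → (x, j) ∈ E ∧
      (∀ y a, (a, (y, j), 1) ∈ C → y ≤ x) ∧ ∀ y a, (a, (y, j), 2) ∈ C → x ≤ y := by
    intro j
    by_cases hN : ∃ i, (i, j) ∈ E
    · obtain ⟨x, hx, h1, h2⟩ := exists_mem_between (N := {i | (i, j) ∈ E})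
        (A := {i | ∃ a, (a, (i, j), 1) ∈ C}) (B := {i | ∃ a, (a, (i, j), 2) ∈ C}) hN
        (finite_right_nbrs E j) (fun j ⟨c, hc⟩ => hE _ _ _ _ hc) (fun j ⟨c, hc⟩ => hE _ _ _ _ hc) (by
          rintro y ⟨c, hc⟩ z ⟨d, hd⟩
          by_contra hlt
          exact hC _ hc _ hd (by simp) (Or.inr (Or.inr
            ⟨rfl, (not_le.1 hlt).ne', Or.inr ⟨not_le.1 hlt, rfl, rfl⟩⟩)))
      exact ⟨x, fun j _ => ⟨hx, fun y c h => h1 y ⟨c, h⟩, fun y c h => h2 y ⟨c, h⟩⟩⟩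
    · exact ⟨0, fun j hj => (hN ⟨j, hj⟩).elim⟩
  choose t ht using hleft
  choose s hs using hright
  refine ⟨⟨t, s, fun i j => (i, j) ∈ E ∧ t i = j ∧ s j = i ∧ (2, (i, j), 1) ∉ C⟩,
    ⟨fun i j h => (ht i j h).1, fun i j h => (hs j i h).1, fun i j h => ⟨h.1, h.2.1, h.2.2.1⟩⟩, ?_⟩
  rintro ⟨a, ⟨i, j⟩, c⟩ hr
  have hij := hE _ _ _ _ hr
  obtain ⟨-, h1, h2⟩ := ht i j hij
  obtain ⟨-, h3, h4⟩ := hs j i hij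
  obtain ⟨ha, -, hc⟩ := hR _ hr
  simp only at ha hc
  refine mem_clique.2 ⟨hij, ?_⟩
  rcases ha with rfl | rfl <;> rcases hc with rfl | rfl
  · simp [h1 _ _ hr, h3 _ _ hr]
  · have h5 : (2, (i, j), 1) ∉ C := fun h => hC _ hr _ h (by simp) (Or.inl (by simp))
    simpa [h1 _ _ hr, h4 _ _ hr, hij, h5] using fun h h' => ⟨h, h'⟩
  · simp [h2 _ _ hr, h3 _ _ hr, hr]
  · simp [h2 _ _ hr, h4 _ _ hr]

theorem isMaxClique_iff {C : Set Route} :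
    IsMaxClique E C ↔ ∃ D : ThresholdData, D.Good E ∧ D.clique E = C := by
  constructor
  · rintro ⟨hC, hmax⟩
    obtain ⟨D, hD, hCD⟩ := exists_good_clique_superset hC
    exact ⟨D, hD, hmax _ isClique_clique hCD⟩
  · rintro ⟨D, hD, rfl⟩
    refine ⟨isClique_clique, fun C' hC' hsub => ?_⟩
    obtain ⟨D', hD', hCD'⟩ := exists_good_clique_superset hC'
    have := (hD.agree_of_clique_subset hD' (hsub.trans hCD')).clique_eq
    exact (this ▸ hCD').antisymm hsub

theorem Good.isMatching_matching (h : D.Good E) : IsMatching E (D.matching E) := by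
  have hd := h.diag_tight
  constructor
  · rintro (⟨i, j⟩ | ⟨i, j⟩ | ⟨j, i⟩) he
    · exact (hd i j (inl_mem_matching.1 he)).1
    · obtain ⟨h1, -, -, j', h2, h3⟩ := inr_inl_mem_matching.1 he
      exact ⟨h1, j', by simpa [Nbr] using h2, h3⟩
    · obtain ⟨h1, -, -, j', h2, h3⟩ := inr_inr_mem_matching.1 he
      exact ⟨h1, j', by simpa [Nbr'] using h2, h3⟩
  · rintro (⟨i, j⟩ | ⟨i, j⟩ | ⟨j, i⟩) he (⟨i', j'⟩ | ⟨i', j'⟩ | ⟨j', i'⟩) he' hne <;>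
      simp only [inl_mem_matching, inr_inl_mem_matching, inr_inr_mem_matching] at he he' <;>
      simp only [leftV, rightV] <;> grind

theorem exists_good_of_isMatching {M : Set WEdge} (hM : IsMatching E M) :
    ∃ D : ThresholdData, D.Good E ∧ D.matching E = M := by
  obtain ⟨hW, hM⟩ := hM
  have hW1 : ∀ i j, Sum.inl (i, j) ∈ M → (i, j) ∈ E := fun i j h => hW _ h
  have hW2 : ∀ i j, Sum.inr (Sum.inl (i, j)) ∈ M → (i, j) ∈ E ∧ ∃ j', (i, j') ∈ E ∧ j' < j := by
    intro i j h
    simpa [IsWEdge, Nbr] using hW _ h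
  have hW3 : ∀ i j, Sum.inr (Sum.inr (j, i)) ∈ M → (i, j) ∈ E ∧ ∃ i', (i', j) ∈ E ∧ i < i' := by
    intro i j h
    simpa [IsWEdge, Nbr'] using hW _ h
  have hleft : ∀ i, ∃ x, ∀ j, (i, j) ∈ E → (i, x) ∈ E ∧
      (∀ y, Sum.inl (i, y) ∈ M ∨ Sum.inr (Sum.inl (i, y)) ∈ M → x = y) ∧
      (Sum.inl (i, x) ∈ M ∨ Sum.inr (Sum.inl (i, x)) ∈ M ∨ ∀ y, (i, y) ∈ E → x ≤ y) := by
    intro i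
    by_cases hy : ∃ y, Sum.inl (i, y) ∈ M ∨ Sum.inr (Sum.inl (i, y)) ∈ M
    · obtain ⟨x, hx⟩ := hy
      refine ⟨x, fun j hj => ⟨by grind, fun y hy => ?_, by grind⟩⟩
      by_contra hne
      rcases hx with hx | hx <;> rcases hy with hy | hy <;>
        simpa [leftV, hne] using (hM _ hx _ hy (by simp [hne])).1
    · by_cases hN : ∃ j, (i, j) ∈ E
      · obtain ⟨x, hx, hmin⟩ := Set.exists_min_image {j | (i, j) ∈ E} id (finite_left_nbrs E i) hN
        exact ⟨x, fun j _ => ⟨hx, fun y h => (hy ⟨y, h⟩).elim, Or.inr (Or.inr hmin)⟩⟩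
      · exact ⟨0, fun j hj => (hN ⟨j, hj⟩).elim⟩
  have hright : ∀ j, ∃ x, ∀ i, (i, j) ∈ E → (x, j) ∈ E ∧
      (∀ y, Sum.inl (y, j) ∈ M ∨ Sum.inr (Sum.inr (j, y)) ∈ M → x = y) ∧
      (Sum.inl (x, j) ∈ M ∨ Sum.inr (Sum.inr (j, x)) ∈ M ∨ ∀ y, (y, j) ∈ E → y ≤ x) := by
    intro j
    by_cases hy : ∃ y, Sum.inl (y, j) ∈ M ∨ Sum.inr (Sum.inr (j, y)) ∈ M
    · obtain ⟨x, hx⟩ := hy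
      refine ⟨x, fun i hi => ⟨by grind, fun y hy => ?_, by grind⟩⟩
      by_contra hne
      rcases hx with hx | hx <;> rcases hy with hy | hy <;>
        simpa [rightV, hne] using (hM _ hx _ hy (by simp [hne])).2
    · by_cases hN : ∃ i, (i, j) ∈ E
      · obtain ⟨x, hx, hmax⟩ := Set.exists_max_image {i | (i, j) ∈ E} id (finite_right_nbrs E j) hN
        exact ⟨x, fun i _ => ⟨hx, fun y h => (hy ⟨y, h⟩).elim, Or.inr (Or.inr hmax)⟩⟩
      · exact ⟨0, fun i hi => (hN ⟨i, hi⟩).elim⟩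
  have hdisjL : ∀ i j, Sum.inl (i, j) ∈ M → Sum.inr (Sum.inl (i, j)) ∉ M := by
    intro i j h h'
    simpa [leftV] using (hM _ h _ h' (by simp)).1
  have hdisjR : ∀ i j, Sum.inl (i, j) ∈ M → Sum.inr (Sum.inr (j, i)) ∉ M := by
    intro i j h h'
    simpa [rightV] using (hM _ h _ h' (by simp)).2
  choose t ht using hleft
  choose s hs using hright
  refine ⟨⟨t, s, fun i j => Sum.inl (i, j) ∈ M⟩,
    ⟨fun i j h => (ht i j h).1, fun i j h => (hs j i h).1, fun i j h => ?_⟩, ?_⟩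
  · have hij := hW1 i j h
    exact ⟨hij, (ht i j hij).2.1 j (Or.inl h), (hs j i hij).2.1 i (Or.inl h)⟩
  · ext (⟨i, j⟩ | ⟨i, j⟩ | ⟨j, i⟩)
    · exact Iff.rfl
    · rw [inr_inl_mem_matching]
      simp only
      constructor
      · rintro ⟨hij, rfl, hn, y, hy, hlt⟩
        have := (ht i _ hij).2.2
        grind
      · intro h
        have hij := hW2 i j h
        exact ⟨hij.1, (ht i j hij.1).2.1 j (Or.inr h), fun h' => hdisjL _ _ h' h, hij.2⟩
    · rw [inr_inr_mem_matching]
      simp only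
      constructor
      · rintro ⟨hij, rfl, hn, y, hy, hlt⟩
        have := (hs j _ hij).2.2
        grind
      · intro h
        have hij := hW3 i j h
        exact ⟨hij.1, (hs j i hij.1).2.1 i (Or.inr h), fun h' => hdisjR _ _ h' h, hij.2⟩

theorem Good.left_le_of_matching_eq (h : D.Good E) (h' : D'.Good E)
    (he : D.matching E = D'.matching E) {i j : ℕ} (hij : (i, j) ∈ E) :
    D'.left i ≤ D.left i := by
  by_contra! hlt
  have h1 : Sum.inr (Sum.inl (i, D'.left i)) ∉ D'.matching E := fun hm => by
    rw [← he, inr_inl_mem_matching] at hm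
    omega
  have h2 : ¬ D'.diag i (D'.left i) := fun hd => by
    rw [← inl_mem_matching (E := E), ← he, inl_mem_matching] at hd
    have := h.diag_tight _ _ hd
    omega
  exact h1 (inr_inl_mem_matching.2 ⟨h'.left_mem i j hij, rfl, h2, _, h.left_mem i j hij, hlt⟩)

theorem Good.right_le_of_matching_eq (h : D.Good E) (h' : D'.Good E)
    (he : D.matching E = D'.matching E) {i j : ℕ} (hij : (i, j) ∈ E) :
    D.right j ≤ D'.right j := by
  by_contra! hlt
  have h1 : Sum.inr (Sum.inr (j, D'.right j)) ∉ D'.matching E := fun hm => by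
    rw [← he, inr_inr_mem_matching] at hm
    omega
  have h2 : ¬ D'.diag (D'.right j) j := fun hd => by
    rw [← inl_mem_matching (E := E), ← he, inl_mem_matching] at hd
    have := h.diag_tight _ _ hd
    omega
  exact h1 (inr_inr_mem_matching.2 ⟨h'.right_mem i j hij, rfl, h2, _, h.right_mem i j hij, hlt⟩)

theorem Good.agree_of_matching_eq (h : D.Good E) (h' : D'.Good E)
    (he : D.matching E = D'.matching E) : Agree E D D' where
  left_eq i j hij :=
    (h'.left_le_of_matching_eq h he.symm hij).antisymm (h.left_le_of_matching_eq h' he hij)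
  right_eq i j hij :=
    (h.right_le_of_matching_eq h' he hij).antisymm (h'.right_le_of_matching_eq h he.symm hij)
  diag_iff i j := by rw [← inl_mem_matching (E := E), he, inl_mem_matching]

/-- `D'` arises from `D` by the elementary move labelled by the edge `e` of `W(H)`. An edge of `H`
is removed from the distinguished set; a pendant edge at a left (right) vertex lowers (raises) its
threshold to the adjacent neighbor. -/
def Step (E : Finset (ℕ × ℕ)) (D D' : ThresholdData) : WEdge → Prop
  | Sum.inl p =>
      (∀ i j, (i, j) ∈ E → D'.left i = D.left i) ∧
      (∀ i j, (i, j) ∈ E → D'.right j = D.right j) ∧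
      ∀ i j, D'.diag i j ↔ D.diag i j ∧ ¬ (i = p.1 ∧ j = p.2)
  | Sum.inr (Sum.inl p) =>
      (∀ i j, (i, j) ∈ E → i ≠ p.1 → D'.left i = D.left i) ∧
      (p.1, D'.left p.1) ∈ E ∧ D'.left p.1 < p.2 ∧
      (∀ j, (p.1, j) ∈ E → j < p.2 → j ≤ D'.left p.1) ∧
      (∀ i j, (i, j) ∈ E → D'.right j = D.right j) ∧
      ∀ i j, D'.diag i j ↔ D.diag i j ∨ (i = p.1 ∧ j = D'.left p.1 ∧ D.right j = i)
  | Sum.inr (Sum.inr q) =>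
      (∀ i j, (i, j) ∈ E → j ≠ q.1 → D'.right j = D.right j) ∧
      (D'.right q.1, q.1) ∈ E ∧ q.2 < D'.right q.1 ∧
      (∀ i, (i, q.1) ∈ E → q.2 < i → D'.right q.1 ≤ i) ∧
      (∀ i j, (i, j) ∈ E → D'.left i = D.left i) ∧
      ∀ i j, D'.diag i j ↔ D.diag i j ∨ (j = q.1 ∧ i = D'.right q.1 ∧ D.left i = j)

theorem Good.exists_step (h : D.Good E) {e : WEdge} (he : e ∈ D.matching E) :
    ∃ D' : ThresholdData, D'.Good E ∧ Step E D D' e := by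
  obtain ⟨hl, hr, hd⟩ := h
  obtain (⟨i, j⟩ | ⟨i, j⟩ | ⟨j, i⟩) := e
  · exact ⟨⟨D.left, D.right, fun x y => D.diag x y ∧ ¬ (x = i ∧ y = j)⟩,
      ⟨hl, hr, fun x y h => hd x y h.1⟩, fun _ _ _ => rfl, fun _ _ _ => rfl, fun _ _ => Iff.rfl⟩
  · obtain ⟨hij, hi, hnd, hex⟩ := inr_inl_mem_matching.1 he
    obtain ⟨p, ⟨hpE, hpj⟩, hp⟩ := Set.exists_max_image {y | (i, y) ∈ E ∧ y < j} id
      ((finite_left_nbrs E i).subset fun _ h => h.1) hex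
    simp only [Set.mem_ofPred_eq, id] at hpE hpj hp
    refine ⟨⟨Function.update D.left i p, D.right,
      fun x y => D.diag x y ∨ (x = i ∧ y = p ∧ D.right y = x)⟩, ⟨?_, hr, ?_⟩, ?_⟩
    · intro x y hxy
      simp only [Function.update_apply]
      grind
    · intro x y hxy
      simp only [Function.update_apply] at hxy ⊢
      grind
    · simp only [Step, Function.update_self]
      exact ⟨fun x y _ hx => Function.update_of_ne hx _ _, hpE, hpj, fun y h1 h2 => hp y ⟨h1, h2⟩,
        by simp, by simp⟩
  · obtain ⟨hij, hi, hnd, hex⟩ := inr_inr_mem_matching.1 he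
    obtain ⟨p, ⟨hpE, hpj⟩, hp⟩ := Set.exists_min_image {x | (x, j) ∈ E ∧ i < x} id
      ((finite_right_nbrs E j).subset fun _ h => h.1) hex
    simp only [Set.mem_ofPred_eq, id] at hpE hpj hp
    refine ⟨⟨D.left, Function.update D.right j p,
      fun x y => D.diag x y ∨ (y = j ∧ x = p ∧ D.left x = y)⟩, ⟨hl, ?_, ?_⟩, ?_⟩
    · intro x y hxy
      simp only [Function.update_apply]
      grind
    · intro x y hxy
      simp only [Function.update_apply] at hxy ⊢
      grind
    · simp only [Step, Function.update_self]
      exact ⟨fun x y _ hx => Function.update_of_ne hx _ _, hpE, hpj, fun y h1 h2 => hp y ⟨h1, h2⟩,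
        by simp, by simp⟩

theorem Step.agree {e : WEdge} (h : Step E D D' e) (h' : Step E D D'' e) : Agree E D' D'' := by
  obtain (⟨i, j⟩ | ⟨i, j⟩ | ⟨j, i⟩) := e
  · obtain ⟨hl, hr, hd⟩ := h
    obtain ⟨hl', hr', hd'⟩ := h'
    exact ⟨by grind, by grind, by grind⟩
  · obtain ⟨hl, h1, h2, h3, hr, hd⟩ := h
    obtain ⟨hl', h1', h2', h3', hr', hd'⟩ := h'
    have heq : D'.left i = D''.left i := (h3' _ h1 h2).antisymm (h3 _ h1' h2')
    exact ⟨by grind, by grind, by grind⟩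
  · obtain ⟨hl, h1, h2, h3, hr, hd⟩ := h
    obtain ⟨hl', h1', h2', h3', hr', hd'⟩ := h'
    have heq : D'.right j = D''.right j := (h3 _ h1' h2').antisymm (h3' _ h1 h2)
    exact ⟨by grind, by grind, by grind⟩

theorem Good.step_inj (h : D.Good E) {e e' : WEdge} (he : e ∈ D.matching E)
    (he' : e' ∈ D.matching E) (hs : Step E D D' e) (hs' : Step E D D' e') : e = e' := by
  have hd := h.diag_tight
  obtain (⟨i, j⟩ | ⟨i, j⟩ | ⟨j, i⟩) := e <;> obtain (⟨x, y⟩ | ⟨x, y⟩ | ⟨y, x⟩) := e' <;>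
    simp only [inl_mem_matching, inr_inl_mem_matching, inr_inr_mem_matching] at he he' <;>
    simp only [Step] at hs hs' <;>
    simp only [Sum.inl.injEq, Sum.inr.injEq, Prod.mk.injEq, reduceCtorEq] <;> grind

theorem Good.ccwStep_of_step (h : D.Good E) (h' : D'.Good E) {e : WEdge} (he : e ∈ D.matching E)
    (hs : Step E D D' e) : CCWStep (D.clique E) (D'.clique E) := by
  obtain ⟨-, -, hd⟩ := h
  obtain ⟨-, -, hd'⟩ := h'
  obtain (⟨i, j⟩ | ⟨i, j⟩ | ⟨j, i⟩) := e
  · obtain ⟨hl, hr, hdd⟩ := hs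
    simp only at hdd
    rw [inl_mem_matching] at he
    have hij := hd i j he
    have := hl i j hij.1
    have := hr i j hij.1
    refine ⟨(1, (i, j), 2), mem_clique.2 (by grind), (2, (i, j), 1), mem_clique.2 (by grind),
      Or.inl (by simp), ?_⟩
    ext ⟨a, ⟨x, y⟩, c⟩
    simp only [Set.mem_sdiff, mem_clique, Set.mem_singleton_iff, Prod.mk.injEq]
    by_cases hxy : (x, y) ∈ E
    · rw [hl x y hxy, hr x y hxy, hdd x y]
      grind
    · simp [hxy]
  · obtain ⟨hij, rfl, hnd, -⟩ := inr_inl_mem_matching.1 he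
    obtain ⟨hl, h1, h2, h3, hr, hdd⟩ := hs
    simp only at hl h1 h2 h3 hr hdd
    have hr1 := hr _ _ hij
    have hr2 := hr _ _ h1
    refine ⟨(1, (i, D.left i), if i ≤ D.right (D.left i) then 1 else 2),
      mem_clique.2 (by split_ifs <;> grind),
      (2, (i, D'.left i), if D'.right (D'.left i) ≤ i then 2 else 1),
      mem_clique.2 (by split_ifs <;> grind), Or.inr (Or.inl (by simpa using h2)), ?_⟩
    ext ⟨a, ⟨x, y⟩, c⟩
    simp only [Set.mem_sdiff, mem_clique, Set.mem_singleton_iff, Prod.mk.injEq]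
    by_cases hxy : (x, y) ∈ E
    · have hdx := hd x y
      have hdx' := hd' x y
      have hrx := hr x y hxy
      have hddx := hdd x y
      by_cases hx : x = i
      · subst hx
        have h3' := h3 y hxy
        split_ifs <;> grind
      · have hlx := hl x y hxy hx
        rw [hlx, hrx, hddx]
        simp [hx]
    · simp [hxy]
  · obtain ⟨hij, rfl, hnd, -⟩ := inr_inr_mem_matching.1 he
    obtain ⟨hl, h1, h2, h3, hr, hdd⟩ := hs
    simp only at hl h1 h2 h3 hr hdd
    have hr1 := hr _ _ hij
    have hr2 := hr _ _ h1
    refine ⟨(if D.left (D.right j) ≤ j then 2 else 1, (D.right j, j), 2),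
      mem_clique.2 (by split_ifs <;> grind),
      (if j ≤ D'.left (D'.right j) then 1 else 2, (D'.right j, j), 1),
      mem_clique.2 (by split_ifs <;> grind), Or.inr (Or.inr (by simpa using h2)), ?_⟩
    ext ⟨a, ⟨x, y⟩, c⟩
    simp only [Set.mem_sdiff, mem_clique, Set.mem_singleton_iff, Prod.mk.injEq]
    by_cases hxy : (x, y) ∈ E
    · have hdx := hd x y
      have hdx' := hd' x y
      have hrx := hr x y hxy
      have hddx := hdd x y
      by_cases hx : y = j
      · subst hx
        have h3' := h3 x hxy
        split_ifs <;> grind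
      · have hlx := hl x y hxy hx
        rw [hlx, hrx, hddx]
        simp [hx]
    · simp [hxy]

theorem Step.congr_right {e : WEdge} (h : Step E D D' e) (hag : Agree E D' D'') :
    Step E D D'' e := by
  obtain ⟨hl, hr, hd⟩ := hag
  obtain (⟨i, j⟩ | ⟨i, j⟩ | ⟨j, i⟩) := e
  · obtain ⟨h1, h2, h3⟩ := h
    exact ⟨by grind, by grind, by grind⟩
  · obtain ⟨h1, h2, h3, h4, h5, h6⟩ := h
    have := hl _ _ h2
    exact ⟨by grind, by grind, by grind, by grind, by grind, by grind⟩
  · obtain ⟨h1, h2, h3, h4, h5, h6⟩ := h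
    have := hr _ _ h2
    exact ⟨by grind, by grind, by grind, by grind, by grind, by grind⟩

theorem Good.exists_step_of_ccwStep (h : D.Good E) (h' : D'.Good E)
    (hc : CCWStep (D.clique E) (D'.clique E)) : ∃ e ∈ D.matching E, Step E D D' e := by
  obtain ⟨r, hr, r', hr', hcw, heq⟩ := hc
  have hrem : ∀ q ∈ D.clique E, q ∉ D'.clique E → q = r := fun q hq hq' => by
    by_contra hne
    exact hq' (heq.subset ⟨hq, hne⟩).1
  have hadd : ∀ q ∈ D'.clique E, q ∉ D.clique E → q = r' := fun q hq hq' => by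
    by_contra hne
    exact hq' (heq.superset ⟨hq, hne⟩).1
  have hd := h.diag_tight
  have hd' := h'.diag_tight
  have hltL : ∀ i j, (i, j) ∈ E → D'.left i < D.left i →
      (∃ c, (1, (i, D.left i), c) = r) ∧ ∃ c, (2, (i, D'.left i), c) = r' := by
    intro i j hij hlt
    obtain ⟨c, h1⟩ := h.exists_one_left_mem hij
    obtain ⟨c', h2⟩ := h'.exists_two_left_mem hij
    exact ⟨⟨c, hrem _ h1 fun hm => by rw [mem_clique] at hm; omega⟩,
      ⟨c', hadd _ h2 fun hm => by rw [mem_clique] at hm; omega⟩⟩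
  have hltR : ∀ i j, (i, j) ∈ E → D.right j < D'.right j →
      (∃ a, (a, (D.right j, j), 2) = r) ∧ ∃ a, (a, (D'.right j, j), 1) = r' := by
    intro i j hij hlt
    obtain ⟨c, h1⟩ := h.exists_two_right_mem hij
    obtain ⟨c', h2⟩ := h'.exists_one_right_mem hij
    exact ⟨⟨c, hrem _ h1 fun hm => by rw [mem_clique] at hm; omega⟩,
      ⟨c', hadd _ h2 fun hm => by rw [mem_clique] at hm; omega⟩⟩
  have hleL : ∀ i j, (i, j) ∈ E → D'.left i ≤ D.left i := by
    intro i j hij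
    by_contra! hlt
    obtain ⟨c, h1⟩ := h.exists_two_left_mem hij
    obtain ⟨c', h2⟩ := h'.exists_one_left_mem hij
    have h3 := hrem _ h1 fun hm => by rw [mem_clique] at hm; omega
    have h4 := hadd _ h2 fun hm => by rw [mem_clique] at hm; omega
    subst h3 h4
    simp only [Clockwise] at hcw
    omega
  have hleR : ∀ i j, (i, j) ∈ E → D.right j ≤ D'.right j := by
    intro i j hij
    by_contra! hlt
    obtain ⟨c, h1⟩ := h.exists_one_right_mem hij
    obtain ⟨c', h2⟩ := h'.exists_two_right_mem hij
    have h3 := hrem _ h1 fun hm => by rw [mem_clique] at hm; omega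
    have h4 := hadd _ h2 fun hm => by rw [mem_clique] at hm; omega
    subst h3 h4
    simp only [Clockwise] at hcw
    omega
  by_cases hL : ∃ i j, (i, j) ∈ E ∧ D'.left i < D.left i
  · obtain ⟨i, j, hij, hlt⟩ := hL
    obtain ⟨⟨c, rfl⟩, c', rfl⟩ := hltL i j hij hlt
    have hl : ∀ x y, (x, y) ∈ E → x ≠ i → D'.left x = D.left x := by
      intro x y hxy hx
      refine (hleL x y hxy).antisymm (not_lt.1 fun hlt' => hx ?_)
      have := (hltL x y hxy hlt').1
      grind
    have hR : ∀ x y, (x, y) ∈ E → D'.right y = D.right y := by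
      intro x y hxy
      refine (not_lt.1 fun hlt' => ?_ : D'.right y ≤ D.right y).antisymm (hleR x y hxy)
      obtain ⟨⟨a, h1⟩, a', h2⟩ := hltR x y hxy hlt'
      grind
    have hmem := h.left_mem i j hij
    have hmem' := h'.left_mem i j hij
    have hnd : ¬ D.diag i (D.left i) := by
      intro hdi
      have h1 := hd _ _ hdi
      have h2 : (1, (i, D.left i), 1) ∈ D.clique E := mem_clique.2 (by grind)
      have h3 : (1, (i, D.left i), 2) ∈ D.clique E := mem_clique.2 (by grind)
      have h4 := hrem _ h2 fun hm => by rw [mem_clique] at hm; omega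
      have h5 := hrem _ h3 fun hm => by rw [mem_clique] at hm; omega
      simp only [Prod.mk.injEq] at h4 h5
      omega
    refine ⟨Sum.inr (Sum.inl (i, D.left i)),
      inr_inl_mem_matching.2 ⟨hmem, rfl, hnd, _, hmem', hlt⟩, hl, hmem', hlt, ?_, hR, ?_⟩
    · intro y hy hylt
      by_contra! hy'
      simp only at hy hylt hy'
      have h1 : ∃ c, (1, (i, y), c) ∈ D.clique E := by
        simp only [mem_clique]
        rcases le_total i (D.right y) with h2 | h2
        · exact ⟨1, by grind⟩
        · exact ⟨2, by grind⟩
      obtain ⟨c2, h1⟩ := h1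
      have h3 := hrem _ h1 fun hm => by rw [mem_clique] at hm; omega
      simp only [Prod.mk.injEq] at h3
      omega
    · intro x y
      simp only
      have key : ∀ x y, (1, (x, y), 2) ∈ D.clique E → ¬ (x = i ∧ y = D.left i) →
          (1, (x, y), 2) ∈ D'.clique E := by
        intro x y h1 h2
        by_contra h3
        have := hrem _ h1 h3
        grind
      have key' : ∀ x y, (1, (x, y), 2) ∈ D'.clique E → (1, (x, y), 2) ∈ D.clique E := by
        intro x y h1
        by_contra h3
        have := hadd _ h1 h3
        grind
      simp only [mem_clique] at key key'
      have hdx := hd x y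
      have hdx' := hd' x y
      have k1 := key x y
      have k2 := key' x y
      have hRx := hR x y
      have hlx := hl x y
      by_cases hx : x = i
      · subst hx
        constructor
        · intro hdi
          grind
        · rintro (hdi | hdi) <;> grind
      · grind
  by_cases hR : ∃ i j, (i, j) ∈ E ∧ D.right j < D'.right j
  · obtain ⟨i, j, hij, hlt⟩ := hR
    obtain ⟨⟨c, rfl⟩, c', rfl⟩ := hltR i j hij hlt
    have hr : ∀ x y, (x, y) ∈ E → y ≠ j → D'.right y = D.right y := by
      intro x y hxy hx
      refine (not_lt.1 fun hlt' => hx ?_ : D'.right y ≤ D.right y).antisymm (hleR x y hxy)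
      have := (hltR x y hxy hlt').1
      grind
    have hL' : ∀ x y, (x, y) ∈ E → D'.left x = D.left x := fun x y hxy =>
      (hleL x y hxy).antisymm (not_lt.1 fun hlt' => hL ⟨x, y, hxy, hlt'⟩)
    have hmem := h.right_mem i j hij
    have hmem' := h'.right_mem i j hij
    have hnd : ¬ D.diag (D.right j) j := by
      intro hdi
      have h1 := hd _ _ hdi
      have h2 : (2, (D.right j, j), 2) ∈ D.clique E := mem_clique.2 (by grind)
      have h3 : (1, (D.right j, j), 2) ∈ D.clique E := mem_clique.2 (by grind)
      have h4 := hrem _ h2 fun hm => by rw [mem_clique] at hm; omega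
      have h5 := hrem _ h3 fun hm => by rw [mem_clique] at hm; omega
      simp only [Prod.mk.injEq] at h4 h5
      omega
    refine ⟨Sum.inr (Sum.inr (j, D.right j)),
      inr_inr_mem_matching.2 ⟨hmem, rfl, hnd, _, hmem', hlt⟩, hr, hmem', hlt, ?_, hL', ?_⟩
    · intro y hy hylt
      by_contra! hy'
      simp only at hy hylt hy'
      have h1 : ∃ a, (a, (y, j), 2) ∈ D.clique E := by
        simp only [mem_clique]
        rcases le_total (D.left y) j with h2 | h2
        · exact ⟨2, by grind⟩
        · exact ⟨1, by grind⟩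
      obtain ⟨c2, h1⟩ := h1
      have h3 := hrem _ h1 fun hm => by rw [mem_clique] at hm; omega
      simp only [Prod.mk.injEq] at h3
      omega
    · intro x y
      simp only
      have key : ∀ x y, (1, (x, y), 2) ∈ D.clique E → ¬ (x = D.right j ∧ y = j) →
          (1, (x, y), 2) ∈ D'.clique E := by
        intro x y h1 h2
        by_contra h3
        have := hrem _ h1 h3
        grind
      have key' : ∀ x y, (1, (x, y), 2) ∈ D'.clique E → (1, (x, y), 2) ∈ D.clique E := by
        intro x y h1
        by_contra h3
        have := hadd _ h1 h3
        grind
      simp only [mem_clique] at key key'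
      have hdx := hd x y
      have hdx' := hd' x y
      have k1 := key x y
      have k2 := key' x y
      have hRx := hL' x y
      have hlx := hr x y
      by_cases hx : y = j
      · subst hx
        constructor
        · intro hdi
          grind
        · rintro (hdi | hdi) <;> grind
      · grind
  have hL' : ∀ x y, (x, y) ∈ E → D'.left x = D.left x := fun x y hxy =>
    (hleL x y hxy).antisymm (not_lt.1 fun hlt' => hL ⟨x, y, hxy, hlt'⟩)
  have hR' : ∀ x y, (x, y) ∈ E → D'.right y = D.right y := fun x y hxy =>
    (not_lt.1 fun hlt' => hR ⟨x, y, hxy, hlt'⟩ : D'.right y ≤ D.right y).antisymm (hleR x y hxy)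
  obtain ⟨a, ⟨i, j⟩, c⟩ := r
  obtain ⟨a', ⟨i', j'⟩, c'⟩ := r'
  have hij := (mem_clique.1 hr).1
  have hij' := (mem_clique.1 hr').1
  have hl1 := hL' i j hij
  have hl2 := hL' i' j' hij'
  have hr1 := hR' i j hij
  have hr2 := hR' i' j' hij'
  rw [mem_clique] at hr hr'
  simp only [Clockwise, Prod.mk.injEq] at hcw
  obtain ⟨⟨rfl, rfl⟩, rfl, rfl, rfl, rfl⟩ : (i = i' ∧ j = j') ∧ a = 1 ∧ c = 2 ∧ a' = 2 ∧ c' = 1 := by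
    refine hcw.resolve_right ?_
    rintro (⟨rfl, hcw⟩ | ⟨rfl, hcw⟩) <;> omega
  have hdij : D.diag i j := by grind
  refine ⟨Sum.inl (i, j), hdij, hL', hR', fun x y => ?_⟩
  have hdx := hd x y
  have hdx' := hd' x y
  have hLx := hL' x y
  have hRx := hR' x y
  constructor
  · intro hxy
    refine ⟨?_, by grind⟩
    by_contra hn
    have h1 : (1, (x, y), 2) ∈ D'.clique E := mem_clique.2 (by grind)
    have := hadd _ h1 fun hm => by rw [mem_clique] at hm; grind
    grind
  · rintro ⟨hxy, hne⟩
    by_contra hn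
    have h1 : (1, (x, y), 2) ∈ D.clique E := mem_clique.2 (by grind)
    have := hrem _ h1 fun hm => by rw [mem_clique] at hm; grind
    grind

theorem ncard_eq_of_relation {α β : Type*} {s : Set α} {t : Set β} (R : α → β → Prop)
    (hs : ∀ a ∈ s, ∃ b ∈ t, R a b) (ht : ∀ b ∈ t, ∃ a ∈ s, R a b)
    (hfun : ∀ a b b', R a b → R a b' → b = b')
    (hinj : ∀ a ∈ s, ∀ a' ∈ s, ∀ b, R a b → R a' b → a = a') : s.ncard = t.ncard := by
  choose f hf hR using hs
  refine Set.ncard_congr f hf (fun a a' ha ha' he => ?_) fun b hb => ?_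
  · exact hinj a ha a' ha' _ (hR a ha) (he ▸ hR a' ha')
  · obtain ⟨a, ha, hab⟩ := ht b hb
    exact ⟨a, ha, hfun _ _ _ (hR a ha) hab⟩

theorem Good.ncard_covers (h : D.Good E) :
    {C' : Set Route | IsMaxClique E C' ∧ CCWStep (D.clique E) C'}.ncard =
      (D.matching E).ncard := by
  symm
  refine ncard_eq_of_relation (fun e C' => ∃ D' : ThresholdData, D'.Good E ∧ D'.clique E = C' ∧
    Step E D D' e) ?_ ?_ ?_ ?_
  · intro e he
    obtain ⟨D', hD', hs⟩ := h.exists_step he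
    exact ⟨_, ⟨isMaxClique_iff.2 ⟨D', hD', rfl⟩, h.ccwStep_of_step hD' he hs⟩, D', hD', rfl, hs⟩
  · rintro C' ⟨hC', hs⟩
    obtain ⟨D', hD', rfl⟩ := isMaxClique_iff.1 hC'
    obtain ⟨e, he, hs⟩ := h.exists_step_of_ccwStep hD' hs
    exact ⟨e, he, D', hD', rfl, hs⟩
  · rintro e _ _ ⟨D', -, rfl, hs⟩ ⟨D'', -, rfl, hs'⟩
    exact (hs.agree hs').clique_eq
  · rintro e he e' he' _ ⟨D', hD', rfl, hs⟩ ⟨D'', hD'', heq, hs'⟩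
    have hag := hD''.agree_of_clique_subset hD' heq.le
    exact h.step_inj he he' hs (hs'.congr_right hag)

end ThresholdData

/-- The number of maximal cliques covered by exactly `k` maximal cliques equals
the number of `k`-matchings of `W(H)`. -/
theorem cliques_by_covers_eq_kmatchings (n m : ℕ) (hn : 1 ≤ n) (hm : 1 ≤ m) (E : Finset (ℕ × ℕ))
    (hE : ∀ p ∈ E, 1 ≤ p.1 ∧ p.1 ≤ n ∧ 1 ≤ p.2 ∧ p.2 ≤ m)
    (hdegS : ∀ i ∈ Finset.Icc 1 n, 2 ≤ (Nbr E i).card)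
    (hdegT : ∀ j ∈ Finset.Icc 1 m, 2 ≤ (Nbr' E j).card) :
    ∀ k : ℕ,
      {C : Set Route | IsMaxClique E C ∧
        {C' : Set Route | IsMaxClique E C' ∧ CCWStep C C'}.ncard = k}.ncard =
      mCount E k := by
  intro k
  refine ThresholdData.ncard_eq_of_relation (fun C M => ∃ D : ThresholdData, D.Good E ∧
    D.clique E = C ∧ D.matching E = M) ?_ ?_ ?_ ?_
  · rintro C ⟨hC, hk⟩
    obtain ⟨D, hD, rfl⟩ := ThresholdData.isMaxClique_iff.1 hC
    exact ⟨_, ⟨hD.isMatching_matching, hD.ncard_covers.symm.trans hk⟩, D, hD, rfl, rfl⟩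
  · rintro M ⟨hM, hk⟩
    obtain ⟨D, hD, rfl⟩ := ThresholdData.exists_good_of_isMatching hM
    exact ⟨_, ⟨ThresholdData.isMaxClique_iff.2 ⟨D, hD, rfl⟩, hD.ncard_covers.trans hk⟩,
      D, hD, rfl, rfl⟩
  · rintro _ _ _ ⟨D, hD, rfl, rfl⟩ ⟨D', hD', heq, rfl⟩
    exact (hD'.agree_of_clique_subset hD heq.le).symm.matching_eq
  · rintro _ - _ - _ ⟨D, hD, rfl, rfl⟩ ⟨D', hD', rfl, heq⟩
    exact (hD'.agree_of_matching_eq hD heq).symm.clique_eq
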